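/- For every z ∈ ℂ \ [0,∞) and every ν ∈ ℝ, the integral ∫_{ν²}^∞ (λ − z)^{−2} (λ − ν²)^{−1/2} dλ converges absolutely and equals (π/2) (ν² − z)^{−3/2}, where the power on the right is the principal branch. -/

import Mathlib

open MeasureTheory Set

lemma aux_s (w : ℂ) (hw : w ∈ Complex.slitPlane) :
    ∃ s : ℂ, 0 < s.re ∧ s ^ 2 = w ∧ w ^ (-(3 : ℂ) / 2) = (s ^ 3)⁻¹ := by
  have hw0 : w ≠ 0 := Complex.slitPlane_ne_zero hw
  refine ⟨Complex.exp (Complex.log w / 2), ?_, ?_, ?_⟩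
  · rw [Complex.exp_re]
    apply mul_pos (Real.exp_pos _)
    have him : (Complex.log w / 2).im = w.arg / 2 := by
      have := Complex.div_ofNat_im (Complex.log w) 2
      rw [Complex.log_im] at this
      exact this
    rw [him]
    apply Real.cos_pos_of_mem_Ioo
    have h1 := Complex.neg_pi_lt_arg w
    have h2 := Complex.arg_le_pi w
    have h3 := (Complex.mem_slitPlane_iff_arg.1 hw).1
    have h4 := lt_of_le_of_ne h2 h3
    constructor <;> linarith
  · rw [← Complex.exp_nat_mul]
    rw [show ((2 : ℕ) : ℂ) * (Complex.log w / 2) = Complex.log w by push_cast; ring]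
    exact Complex.exp_log hw0
  · rw [← Complex.exp_nat_mul, Complex.cpow_def_of_ne_zero hw0, ← Complex.exp_neg]
    congr 1
    push_cast
    ring

lemma aux_bound (s : ℂ) (hs : 0 < s.re) (u : ℝ) (hu : 0 ≤ u) :
    s.re ^ 2 * (s.re ^ 2 + u ^ 2) ≤ ‖((u : ℂ) ^ 2 + s ^ 2) ^ 2‖ := by
  rw [norm_pow, Complex.sq_norm, Complex.normSq_apply]
  simp only [pow_two, Complex.add_re, Complex.add_im, Complex.mul_re, Complex.mul_im,
    Complex.ofReal_re, Complex.ofReal_im]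
  obtain ⟨p, q⟩ := s
  simp only at *
  have key : (u * u - 0 * 0 + (p * p - q * q)) * (u * u - 0 * 0 + (p * p - q * q)) +
      (u * 0 + 0 * u + (p * q + q * p)) * (u * 0 + 0 * u + (p * q + q * p)) =
      (p ^ 2 + (q + u) ^ 2) * (p ^ 2 + (q - u) ^ 2) := by ring
  rw [key]
  rcases le_total 0 q with h | h
  · have : p ^ 2 + u ^ 2 ≤ p ^ 2 + (q + u) ^ 2 := by nlinarith
    calc _ ≤ p * p * (p ^ 2 + u ^ 2) := by nlinarith
      _ ≤ (p ^ 2 + (q - u) ^ 2) * (p ^ 2 + (q + u) ^ 2) := by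
        gcongr; nlinarith [sq_nonneg (q - u)]
      _ = _ := by ring
  · have : p ^ 2 + u ^ 2 ≤ p ^ 2 + (q - u) ^ 2 := by nlinarith
    calc _ ≤ p * p * (p ^ 2 + u ^ 2) := by nlinarith
      _ ≤ (p ^ 2 + (q + u) ^ 2) * (p ^ 2 + (q - u) ^ 2) := by
        gcongr; nlinarith [sq_nonneg (q + u)]

lemma aux_dom (p a : ℝ) (hp : 0 < p) :
    IntegrableOn (fun x : ℝ => (p ^ 2 * (p ^ 2 + (√(x - a)) ^ 2))⁻¹ * (√(x - a))⁻¹) (Ioi a) := by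
  have := integrableOn_Ioi_deriv_of_nonneg (a := a)
    (g := fun x => 2 / p ^ 3 * Real.arctan (√(x - a) / p))
    (g' := fun x : ℝ => (p ^ 2 * (p ^ 2 + (√(x - a)) ^ 2))⁻¹ * (√(x - a))⁻¹)
    (l := 2 / p ^ 3 * (Real.pi / 2)) ?_ ?_ ?_ ?_
  · exact this
  · apply Continuous.continuousWithinAt
    have := Real.continuous_arctan
    fun_prop
  · intro x hx
    have hx : 0 < x - a := sub_pos.2 hx
    have h0 : 0 < √(x - a) := Real.sqrt_pos.2 hx
    have h1 : HasDerivAt (fun x => √(x - a)) (1 / (2 * √(x - a))) x :=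
      ((hasDerivAt_id x).sub_const a).sqrt hx.ne'
    have h2 := ((h1.div_const p).arctan).const_mul (2 / p ^ 3)
    refine HasDerivAt.congr_deriv h2 ?_
    clear h1 h2
    generalize √(x - a) = u at *
    have h3 : 0 < p ^ 2 + u ^ 2 := by positivity
    have h4 : 0 < 1 + (u / p) ^ 2 := by positivity
    have h5 : 1 + (u / p) ^ 2 = (p ^ 2 + u ^ 2) / p ^ 2 := by field_simp
    rw [h5]
    field_simp
  · intro x hx
    positivity
  · apply Filter.Tendsto.const_mul
    have h1 : Filter.Tendsto (fun x : ℝ => √(x - a) / p) Filter.atTop Filter.atTop := by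
      apply Filter.Tendsto.atTop_div_const hp
      apply Real.tendsto_sqrt_atTop.comp
      exact Filter.tendsto_atTop_add_const_right _ (-a) Filter.tendsto_id
    exact (Real.tendsto_arctan_atTop.mono_right nhdsWithin_le_nhds).comp h1

noncomputable def auxG (s : ℂ) (u : ℝ) : ℂ :=
  (u : ℂ) / (s ^ 2 * ((u : ℂ) ^ 2 + s ^ 2)) +
    (1 / (2 * Complex.I * s ^ 3)) *
      (Complex.log (s + Complex.I * u) - Complex.log (s - Complex.I * u))

lemma aux_ne (s : ℂ) (hs : 0 < s.re) (u : ℝ) :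
    s ≠ 0 ∧ s + Complex.I * u ∈ Complex.slitPlane ∧ s - Complex.I * u ∈ Complex.slitPlane ∧
    (u : ℂ) ^ 2 + s ^ 2 ≠ 0 := by
  have h1 : s + Complex.I * u ∈ Complex.slitPlane := Or.inl (by simpa using hs)
  have h2 : s - Complex.I * u ∈ Complex.slitPlane := Or.inl (by simpa using hs)
  refine ⟨?_, h1, h2, ?_⟩
  · rintro rfl; simp at hs
  · have : (u : ℂ) ^ 2 + s ^ 2 = (s + Complex.I * u) * (s - Complex.I * u) := by
      linear_combination ((u : ℂ) ^ 2) * Complex.I_sq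
    rw [this]
    exact mul_ne_zero (Complex.slitPlane_ne_zero h1) (Complex.slitPlane_ne_zero h2)

lemma auxG_deriv (s : ℂ) (hs : 0 < s.re) (u : ℝ) :
    HasDerivAt (auxG s) (2 / ((u : ℂ) ^ 2 + s ^ 2) ^ 2) u := by
  obtain ⟨h0, h1, h2, h3⟩ := aux_ne s hs u
  have hu : HasDerivAt (fun u : ℝ => (u : ℂ)) 1 u := Complex.ofRealCLM.hasDerivAt
  have ha := hu.div (((hu.pow 2).add_const (s ^ 2)).const_mul (s ^ 2))
    (mul_ne_zero (pow_ne_zero 2 h0) h3)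
  have hb := (((hu.const_mul Complex.I).const_add s).clog_real h1)
  have hc := (((hu.const_mul Complex.I).const_sub s).clog_real h2)
  have hd := ha.add ((hb.sub hc).const_mul (1 / (2 * Complex.I * s ^ 3)))
  refine HasDerivAt.congr_deriv hd ?_
  have h1' := Complex.slitPlane_ne_zero h1
  have h2' := Complex.slitPlane_ne_zero h2
  have e : (u : ℂ) ^ 2 + s ^ 2 = (s + Complex.I * u) * (s - Complex.I * u) := by
    linear_combination ((u : ℂ) ^ 2) * Complex.I_sq
  have key : Complex.I * 1 / (s + Complex.I * u) - -(Complex.I * 1) / (s - Complex.I * u)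
      = 2 * Complex.I * s / ((u : ℂ) ^ 2 + s ^ 2) := by
    rw [e]
    field_simp
    ring
  rw [key]
  simp only [Pi.pow_apply]
  have hI := Complex.I_ne_zero
  field_simp
  push_cast
  ring

lemma auxG_lim (s : ℂ) (hs : 0 < s.re) :
    Filter.Tendsto (auxG s) Filter.atTop (nhds ((Real.pi / 2 : ℝ) * (s ^ 3)⁻¹)) := by
  have hs0 := (aux_ne s hs 0).1
  have hinv : Filter.Tendsto (fun u : ℝ => ((u⁻¹ : ℝ) : ℂ)) Filter.atTop (nhds 0) := by
    have := (Complex.continuous_ofReal.tendsto 0).comp (tendsto_inv_atTop_zero (𝕜 := ℝ))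
    rw [Complex.ofReal_zero] at this
    exact this
  have hA : Filter.Tendsto (fun u : ℝ => ((u⁻¹ : ℝ) : ℂ) / (s ^ 2 * (1 + s ^ 2 * ((u⁻¹ : ℝ) : ℂ) ^ 2)))
      Filter.atTop (nhds (0 / (s ^ 2 * (1 + s ^ 2 * 0 ^ 2)))) := by
    apply hinv.div
    · exact ((hinv.pow 2).const_mul _ |>.const_add 1).const_mul _
    · simpa using hs0
  have hB : Filter.Tendsto (fun u : ℝ => Complex.log (s * ((u⁻¹ : ℝ) : ℂ) + Complex.I))
      Filter.atTop (nhds (Complex.log (s * 0 + Complex.I))) := by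
    apply Filter.Tendsto.clog
    · exact (hinv.const_mul s).add_const _
    · right; simp
  have hC : Filter.Tendsto (fun u : ℝ => Complex.log (s * ((u⁻¹ : ℝ) : ℂ) - Complex.I))
      Filter.atTop (nhds (Complex.log (s * 0 - Complex.I))) := by
    apply Filter.Tendsto.clog
    · exact (hinv.const_mul s).sub_const _
    · right; simp
  have hD := hA.add ((hB.sub hC).const_mul (1 / (2 * Complex.I * s ^ 3)))
  have hval : (0 / (s ^ 2 * (1 + s ^ 2 * 0 ^ 2))) + (1 / (2 * Complex.I * s ^ 3)) *
      (Complex.log (s * 0 + Complex.I) - Complex.log (s * 0 - Complex.I)) =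
      ((Real.pi / 2 : ℝ) * (s ^ 3)⁻¹) := by
    simp only [mul_zero, zero_add, zero_sub, Complex.log_I, Complex.log_neg_I]
    have hI := Complex.I_ne_zero
    push_cast
    field_simp
    ring
  rw [hval] at hD
  refine hD.congr' ?_
  filter_upwards [Filter.eventually_gt_atTop 0] with u hu
  obtain ⟨_, h1, h2, h3⟩ := aux_ne s hs u
  have huc : (u : ℂ) ≠ 0 := by exact_mod_cast hu.ne'
  unfold auxG
  have e1 : s + Complex.I * u = (u : ℝ) * (s * ((u⁻¹ : ℝ) : ℂ) + Complex.I) := by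
    push_cast; field_simp
  have e2 : s - Complex.I * u = (u : ℝ) * (s * ((u⁻¹ : ℝ) : ℂ) - Complex.I) := by
    push_cast; field_simp
  have n1 : s * ((u⁻¹ : ℝ) : ℂ) + Complex.I ≠ 0 := by
    intro h; rw [h, mul_zero] at e1; exact Complex.slitPlane_ne_zero h1 e1
  have n2 : s * ((u⁻¹ : ℝ) : ℂ) - Complex.I ≠ 0 := by
    intro h; rw [h, mul_zero] at e2; exact Complex.slitPlane_ne_zero h2 e2
  rw [e1, e2, Complex.log_ofReal_mul hu n1, Complex.log_ofReal_mul hu n2, add_sub_add_left_eq_sub]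
  congr 1
  have e3 : 1 + s ^ 2 * ((u⁻¹ : ℝ) : ℂ) ^ 2 = ((u : ℂ) ^ 2 + s ^ 2) / (u : ℂ) ^ 2 := by
    push_cast; field_simp
  rw [e3]
  push_cast
  field_simp

/-- For every `z ∈ ℂ \ [0,∞)` and every `ν ∈ ℝ`, the integral
`∫_{ν²}^∞ (λ - z)^{-2} (λ - ν²)^{-1/2} dλ` converges absolutely and equals
`(π/2) (ν² - z)^{-3/2}` (principal branch). -/
theorem stmt_17 (z : ℂ) (hz : z.im ≠ 0 ∨ z.re < 0) (ν : ℝ) :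
    IntegrableOn
      (fun lam : ℝ => (((lam : ℂ) - z) ^ 2)⁻¹ * (((Real.sqrt (lam - ν ^ 2))⁻¹ : ℝ) : ℂ))
      (Ioi (ν ^ 2)) ∧
    ∫ lam in Ioi (ν ^ 2), (((lam : ℂ) - z) ^ 2)⁻¹ * (((Real.sqrt (lam - ν ^ 2))⁻¹ : ℝ) : ℂ)
      = ((Real.pi / 2 : ℝ) : ℂ) * ((ν : ℂ) ^ 2 - z) ^ (-(3 : ℂ) / 2) := by
  have hw : (ν : ℂ) ^ 2 - z ∈ Complex.slitPlane := by
    rw [← Complex.ofReal_pow]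
    rcases hz with h | h
    · right
      rw [Complex.sub_im, Complex.ofReal_im]
      simpa using h
    · left
      rw [Complex.sub_re, Complex.ofReal_re]
      nlinarith [sq_nonneg ν]
  obtain ⟨s, hs, hs2, hs3⟩ := aux_s _ hw
  have hlam : ∀ x ∈ Ioi (ν ^ 2), (x : ℂ) - z = ((√(x - ν ^ 2) : ℝ) : ℂ) ^ 2 + s ^ 2 := by
    intro x hx
    rw [← Complex.ofReal_pow, Real.sq_sqrt (sub_pos.2 hx).le, hs2]
    push_cast; ring
  have hint : IntegrableOn
      (fun lam : ℝ => (((lam : ℂ) - z) ^ 2)⁻¹ * (((Real.sqrt (lam - ν ^ 2))⁻¹ : ℝ) : ℂ))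
      (Ioi (ν ^ 2)) := by
    refine Integrable.mono' (aux_dom s.re (ν ^ 2) hs) ?_ ?_
    · apply Measurable.aestronglyMeasurable
      fun_prop
    · refine (ae_restrict_iff' measurableSet_Ioi).2 (Filter.Eventually.of_forall ?_)
      intro x hx
      rw [hlam x hx, norm_mul, norm_inv, Complex.norm_real, Real.norm_of_nonneg (by positivity)]
      gcongr
      exact aux_bound s hs _ (Real.sqrt_nonneg _)
  refine ⟨hint, ?_⟩
  rw [hs3]
  have hc : Continuous (auxG s) :=
    continuous_iff_continuousAt.2 fun u => (auxG_deriv s hs u).continuousAt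
  have := integral_Ioi_of_hasDerivAt_of_tendsto (a := ν ^ 2)
    (f := fun x => auxG s √(x - ν ^ 2)) (m := (Real.pi / 2 : ℝ) * (s ^ 3)⁻¹)
    (by apply Continuous.continuousWithinAt; fun_prop) ?_ hint ?_
  · rw [this]
    simp [auxG]
  · intro x hx
    have hx' : 0 < x - ν ^ 2 := sub_pos.2 hx
    have h0 : 0 < √(x - ν ^ 2) := Real.sqrt_pos.2 hx'
    have h1 : HasDerivAt (fun x => √(x - ν ^ 2)) (1 / (2 * √(x - ν ^ 2))) x :=
      ((hasDerivAt_id x).sub_const (ν ^ 2)).sqrt hx'.ne'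
    have h2 := (auxG_deriv s hs (√(x - ν ^ 2))).scomp x h1
    refine HasDerivAt.congr_deriv h2 ?_
    rw [hlam x hx, Complex.real_smul]
    have hn := (aux_ne s hs (√(x - ν ^ 2))).2.2.2
    have hn2 : ((√(x - ν ^ 2) : ℝ) : ℂ) ≠ 0 := by exact_mod_cast h0.ne'
    push_cast
    field_simp
  · apply (auxG_lim s hs).comp
    apply Real.tendsto_sqrt_atTop.comp
    exact Filter.tendsto_atTop_add_const_right _ (-(ν ^ 2)) Filter.tendsto_id
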